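/- Let n ≥ 3 be odd. Let Sat be the set of local deterministic strategies s : Fin n → (Fin 2 → Fin 2) that saturate GYNI_n, and let 𝟙 denote the strategy each of whose components is the constant function 1. Then: (a) the box P_𝟙 does not lie in the affine span over ℝ of { P_s : s ∈ Sat }; and (b) for every strategy t, the box P_t lies in the affine span over ℝ of { P_s : s ∈ Sat } ∪ { P_𝟙 }. Consequently the boxes of the saturating strategies affinely span a subspace of codimension one in the affine hull of all local deterministic boxes; that is, the GYNI_n Bell inequality is tight (defines a facet of the polytope of classical correlations) for every odd n. -/

import Mathlib

noncomputable section

/-- Cyclic successor on `Fin n`. -/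
def cnext {n : ℕ} (i : Fin n) : Fin n := ⟨((i : ℕ) + 1) % n, Nat.mod_lt _ i.pos⟩

/-- The box of a local deterministic strategy `s`, as a vector indexed by pairs
`(a, x)` of output and input bit strings: `P_s(a|x) = ∏_i [a_i = s_i(x_i)]`. -/
def stratBox {n : ℕ} (s : Fin n → Fin 2 → Fin 2) :
    (Fin n → Fin 2) × (Fin n → Fin 2) → ℝ :=
  fun ax => ∏ i, if ax.1 i = s i (ax.2 i) then 1 else 0

/-- Even parity of a bit string: `x₁ ⊕ ⋯ ⊕ x_n = 0`. -/
def parity0 {n : ℕ} (x : Fin n → Fin 2) : Prop := (∑ i, (x i : ℕ)) % 2 = 0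

/-- A strategy `s` saturates the GYNI_n inequality (for odd `n`) iff there is a bit string
`x` of even parity with `x_{i+1} = s_i(x_i)` for all `i` (indices cyclic). -/
def Saturates {n : ℕ} (s : Fin n → Fin 2 → Fin 2) : Prop :=
  ∃ x : Fin n → Fin 2, parity0 x ∧ ∀ i, x (cnext i) = s i (x i)

/-- The constant strategy associated to a bit string `c`. -/
def constStrat {n : ℕ} (c : Fin n → Fin 2) : Fin n → Fin 2 → Fin 2 := fun j _ => c j

open Function

section CyclicSuccessor

variable {n : ℕ}

lemma cnext_iterate_val (i : Fin n) (k : ℕ) : ((cnext^[k] i : Fin n) : ℕ) = (i + k) % n := by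
  induction k with
  | zero => simp [Nat.mod_eq_of_lt i.isLt]
  | succ k ih => simp [iterate_succ_apply', cnext, ih, add_assoc]

lemma cnext_induction {p : Fin n → Prop} {i : Fin n} (hi : p i)
    (h : ∀ j, p j → p (cnext j)) (j : Fin n) : p j := by
  have hp (k : ℕ) : p (cnext^[k] i) := by
    induction k with
    | zero => exact hi
    | succ k ih => rw [iterate_succ_apply']; exact h _ ih
  have hj : cnext^[j + (n - i)] i = j := by
    ext
    rw [cnext_iterate_val, show (i : ℕ) + (j + (n - i)) = j + n by omega, Nat.add_mod_right,
      Nat.mod_eq_of_lt j.isLt]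
  exact hj ▸ hp _

lemma cnext_val (i : Fin n) : (cnext i : ℕ) = if (i : ℕ) + 1 = n then 0 else (i : ℕ) + 1 := by
  have := i.isLt
  split_ifs with h
  · simp [cnext, h]
  · exact Nat.mod_eq_of_lt (by omega)

lemma cnext_injective : Injective (cnext : Fin n → Fin n) := by
  intro i j h
  have h' := congrArg Fin.val h
  rw [cnext_val, cnext_val] at h'
  ext
  split_ifs at h' <;> omega

lemma cnext_ne (hn : 2 ≤ n) (i : Fin n) : cnext i ≠ i := by
  intro h
  have h' := congrArg Fin.val h
  rw [cnext_val] at h'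
  split_ifs at h' <;> omega

/-- The distance from `cnext i` to `j` along the cycle. -/
def cdist (i j : Fin n) : ℕ := if (i : ℕ) < j then j - (i + 1) else j + n - (i + 1)

lemma cdist_cnext_self (i : Fin n) : cdist i (cnext i) = 0 := by
  unfold cdist
  rw [cnext_val]
  split_ifs <;> omega

lemma cdist_cnext {i j : Fin n} (h : j ≠ i) : cdist i (cnext j) = cdist i j + 1 := by
  have h' : (j : ℕ) ≠ i := fun e => h (Fin.ext e)
  unfold cdist
  rw [cnext_val]
  split_ifs <;> omega

lemma cnext_iterate_cdist (i j : Fin n) : cnext^[cdist i j] (cnext i) = j := by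
  refine cnext_induction (p := fun j => cnext^[cdist i j] (cnext i) = j) (i := cnext i) ?_ ?_ j
  · simp [cdist_cnext_self]
  · intro j hj
    by_cases h : j = i
    · subst h; simp [cdist_cnext_self]
    · rw [cdist_cnext h, iterate_succ_apply', hj]

/-- Feeding outputs forward along the cycle, starting with the value `v` at `cnext i`. -/
lemma exists_feedforward (t : Fin n → Fin 2 → Fin 2) (i : Fin n) (v : Fin 2) :
    ∃ x : Fin n → Fin 2, x (cnext i) = v ∧ ∀ j, j ≠ i → x (cnext j) = t j (x j) := by
  let y : ℕ → Fin 2 := fun k =>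
    Nat.rec v (fun k b => t (cnext^[k] (cnext i)) b) k
  refine ⟨fun j => y (cdist i j), by simp [cdist_cnext_self, y], fun j hj => ?_⟩
  simp only [cdist_cnext hj]
  change t (cnext^[cdist i j] (cnext i)) (y (cdist i j)) = _
  rw [cnext_iterate_cdist]

end CyclicSuccessor

section Parity

variable {n : ℕ}

lemma parity0_compl (hodd : Odd n) (x : Fin n → Fin 2) :
    parity0 (fun i => x i + 1) ↔ ¬ parity0 x := by
  have h : ∑ i, (x i : ℕ) + ∑ i, ((x i + 1 : Fin 2) : ℕ) = n := by
    rw [← Finset.sum_add_distrib]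
    have hb : ∀ a : Fin 2, (a : ℕ) + ((a + 1 : Fin 2) : ℕ) = 1 := by decide
    simp [hb]
  have := Nat.odd_iff.mp hodd
  simp only [parity0]
  omega

lemma parity0_update (x : Fin n → Fin 2) (p : Fin n) :
    parity0 (update x p (x p + 1)) ↔ ¬ parity0 x := by
  have hx := Finset.add_sum_erase Finset.univ (fun i => (x i : ℕ)) (Finset.mem_univ p)
  have hy := Finset.add_sum_erase Finset.univ
    (fun i => (update x p (x p + 1) i : ℕ)) (Finset.mem_univ p)
  have he : ∑ i ∈ Finset.univ.erase p, (update x p (x p + 1) i : ℕ) =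
      ∑ i ∈ Finset.univ.erase p, (x i : ℕ) :=
    Finset.sum_congr rfl fun i hi => by rw [update_of_ne (Finset.ne_of_mem_erase hi)]
  have hb : ∀ a : Fin 2, (a : ℕ) + ((a + 1 : Fin 2) : ℕ) = 1 := by decide
  have hp := hb (x p)
  simp only [he, update_self] at hy
  unfold parity0
  omega

end Parity

/-- `S` contains the saturating strategies, and is closed under completing the linear relation
`P[f] + P[f + 1] = P[g] + P[g + 1]` between boxes differing in one component. -/
structure ExchangeClosed {n : ℕ} (S : (Fin n → Fin 2 → Fin 2) → Prop) : Prop where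
  of_saturates : ∀ s, Saturates s → S s
  exchange : ∀ t i (f g : Fin 2 → Fin 2), S (update t i f) →
    S (update t i fun b => f b + 1) → S (update t i fun b => g b + 1) → S (update t i g)

/-- `x` is a fixed point of the cyclic feed-forward of `t`. -/
def IsFeedback {n : ℕ} (t : Fin n → Fin 2 → Fin 2) (x : Fin n → Fin 2) : Prop :=
  ∀ i, x (cnext i) = t i (x i)

/-- The constant strategy for which `x` is the feedback string. -/
abbrev shiftStrat {n : ℕ} (x : Fin n → Fin 2) : Fin n → Fin 2 → Fin 2 :=
  constStrat fun i => x (cnext i)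

namespace ExchangeClosed

variable {n : ℕ} {S : (Fin n → Fin 2 → Fin 2) → Prop}

lemma of_isFeedback (hS : ExchangeClosed S) {t : Fin n → Fin 2 → Fin 2} {x : Fin n → Fin 2}
    (hx : parity0 x) (h : IsFeedback t x) : S t :=
  hS.of_saturates t ⟨x, hx, h⟩

lemma update_iff_update (hS : ExchangeClosed S) {t : Fin n → Fin 2 → Fin 2} {i : Fin n}
    {f g : Fin 2 → Fin 2} (hf : S (update t i fun b => f b + 1))
    (hg : S (update t i fun b => g b + 1)) : S (update t i f) ↔ S (update t i g) :=
  ⟨fun h => hS.exchange t i f g h hf hg, fun h => hS.exchange t i g f h hg hf⟩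

/-- A component whose successor is constant may be replaced by a constant one. -/
lemma iff_update_const (hS : ExchangeClosed S) (hn : 2 ≤ n) {t : Fin n → Fin 2 → Fin 2}
    {x : Fin n → Fin 2} (h : IsFeedback t x) {i : Fin n}
    (hc : ∀ a b, t (cnext i) a = t (cnext i) b) :
    S t ↔ S (update t i fun _ => x (cnext i)) := by
  by_cases hx : parity0 x
  · refine iff_of_true (hS.of_isFeedback hx h) (hS.of_isFeedback hx fun j => ?_)
    by_cases hj : j = i
    · subst hj; simp
    · rw [update_of_ne hj]; exact h j
  have key (f : Fin 2 → Fin 2) (hf : f (x i) = x (cnext i)) :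
      S (update t i fun b => f b + 1) := by
    refine hS.of_isFeedback ((parity0_update x (cnext i)).mpr hx) fun j => ?_
    by_cases hj : j = i
    · subst hj
      simp [update_of_ne (cnext_ne hn j).symm, hf]
    · rw [update_of_ne (cnext_injective.ne hj), update_of_ne hj, h j]
      by_cases hj' : j = cnext i
      · subst hj'; exact hc _ _
      · rw [update_of_ne hj']
  conv_lhs => rw [← update_eq_self i t]
  exact hS.update_iff_update (key _ (h i).symm) (key _ rfl)

lemma iff_shiftStrat (hS : ExchangeClosed S) (hn : 2 ≤ n) {t : Fin n → Fin 2 → Fin 2}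
    {x : Fin n → Fin 2} (h : IsFeedback t x) {i : Fin n} (hc : ∀ a b, t i a = t i b) :
    S t ↔ S (shiftStrat x) := by
  induction hN : (Finset.univ.filter fun j => ¬ ∀ a b, t j a = t j b).card using
    Nat.strong_induction_on generalizing t with
  | _ N ih =>
  by_cases hall : ∀ j, ∀ a b, t j a = t j b
  · have : t = shiftStrat x := by
      funext j b
      rw [hall j b (x j), ← h j]; rfl
    rw [this]
  obtain ⟨j, hj, hj'⟩ : ∃ j, (¬ ∀ a b, t j a = t j b) ∧ ∀ a b, t (cnext j) a = t (cnext j) b := by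
    by_contra! hno
    obtain ⟨k, hk⟩ := not_forall.mp hall
    refine cnext_induction (p := fun j => ¬ ∀ a b, t j a = t j b) hk (fun j hj => ?_) i hc
    obtain ⟨a, b, hab⟩ := hno j (by push Not at hj; exact hj)
    exact fun h => hab (h a b)
  have hij : i ≠ j := by rintro rfl; exact hj hc
  rw [hS.iff_update_const hn h hj']
  refine ih _ ?_ (fun k => ?_) ?_ rfl
  · rw [← hN]
    refine Finset.card_lt_card
      (Finset.ssubset_iff_of_subset ?_ |>.mpr ⟨j, by simpa using hj, by simp⟩)
    intro k hk
    by_cases hkj : k = j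
    · subst hkj; simp at hk
    · simpa [update_of_ne hkj] using hk
  · by_cases hkj : k = j
    · subst hkj; simp
    · rw [update_of_ne hkj]; exact h k
  · rwa [update_of_ne hij]

/-- For a strategy without constant components, membership in `S` is equivalent to membership of
the constant strategy of any odd string violating exactly one feedback equation. -/
lemma add_iff_shiftStrat (hS : ExchangeClosed S) (hn : 2 ≤ n) (hodd : Odd n) {d z : Fin n → Fin 2}
    {i : Fin n} (hz : ¬ parity0 z) (hzi : z (cnext i) = z i + d i + 1)
    (h : ∀ j, j ≠ i → z (cnext j) = z j + d j) :
    S (fun j b => b + d j) ↔ S (shiftStrat z) := by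
  have hc : IsFeedback (update (fun j b => b + d j) i fun _ => z (cnext i)) z := by
    intro j
    by_cases hj : j = i
    · subst hj; simp
    · rw [update_of_ne hj]; exact h j hj
  rw [← hS.iff_shiftStrat hn hc (i := i) (by simp)]
  conv_lhs => rw [← update_eq_self i (fun j b => b + d j)]
  have hcompl := (parity0_compl hodd z).mpr hz
  have hb : ∀ a b : Fin 2, a + b + 1 + 1 = a + 1 + b + 1 := by decide
  apply hS.update_iff_update <;> refine hS.of_isFeedback hcompl fun j => ?_
  all_goals
    by_cases hj : j = i
    · subst hj
      simp [hzi, hb]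
    · rw [update_of_ne hj, h j hj]
      generalize z j = a, d j = b
      revert a b; decide

lemma shiftStrat_iff_compl_update (hS : ExchangeClosed S) (hn : 2 ≤ n) (hodd : Odd n)
    {x : Fin n → Fin 2} (hx : ¬ parity0 x) (i : Fin n) :
    S (shiftStrat x) ↔
      S (shiftStrat fun j => update x (cnext i) (x (cnext i) + 1) j + 1) := by
  have hne := cnext_ne hn i
  let d : Fin n → Fin 2 := update (fun j => x j + x (cnext j)) i (x i + x (cnext i) + 1)
  rw [← hS.add_iff_shiftStrat hn hodd (d := d) (i := i) hx,
    ← hS.add_iff_shiftStrat hn hodd (d := d) (i := cnext i)]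
  · rw [parity0_compl hodd, parity0_update]; exact fun h => h hx
  · rw [update_of_ne (cnext_ne hn _)]
    simp only [d, update_of_ne hne, update_self]
    generalize x (cnext i) = a, x (cnext (cnext i)) = b
    revert a b; decide
  · intro j hj
    rw [update_of_ne hj]
    by_cases hji : j = i
    · subst hji
      simp only [d, update_self]
      generalize x (cnext j) = a, x j = b
      revert a b; decide
    · rw [update_of_ne (cnext_injective.ne hji)]
      simp only [d, update_of_ne hji]
      generalize x (cnext j) = a, x j = b
      revert a b; decide
  · simp only [d, update_self]
    generalize x (cnext i) = a, x i = b
    revert a b; decide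
  · intro j hj
    simp only [d, update_of_ne hj]
    generalize x (cnext j) = a, x j = b
    revert a b; decide

lemma exists_cnext_eq (p : Fin n) : ∃ i, cnext i = p :=
  (Finite.injective_iff_surjective.mp cnext_injective) p

lemma shiftStrat_iff_flip_pair (hS : ExchangeClosed S) (hn : 2 ≤ n) (hodd : Odd n)
    {x : Fin n → Fin 2} (hx : ¬ parity0 x) {p q : Fin n} (hpq : p ≠ q) :
    S (shiftStrat x) ↔ S (shiftStrat (update (update x p (x p + 1)) q (x q + 1))) := by
  obtain ⟨i, rfl⟩ := exists_cnext_eq p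
  obtain ⟨k, rfl⟩ := exists_cnext_eq q
  rw [hS.shiftStrat_iff_compl_update hn hodd hx i, hS.shiftStrat_iff_compl_update hn hodd _ k]
  · apply iff_of_eq
    congr 2
    funext j
    have h2 : ∀ a : Fin 2, a + 1 + 1 = a := by decide
    by_cases hj : j = cnext k
    · subst hj; simp [update_of_ne hpq.symm, h2]
    · simp [update_of_ne hj, h2]
  · rw [parity0_compl hodd, parity0_update]; exact fun h => h hx

lemma shiftStrat_of_odd (hS : ExchangeClosed S) (hn : 2 ≤ n) (hodd : Odd n)
    (h1 : S (constStrat fun _ => 1)) {x : Fin n → Fin 2} (hx : ¬ parity0 x) :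
    S (shiftStrat x) := by
  induction hN : (Finset.univ.filter fun j => x j = 0).card using
    Nat.strong_induction_on generalizing x with
  | _ N ih =>
  have hb : ∀ a : Fin 2, a ≠ 0 → a = 1 := by decide
  by_cases hall : ∀ p, x p = 1
  · have : x = fun _ => 1 := funext hall
    subst this; exact h1
  obtain ⟨p, hp⟩ := not_forall.mp hall
  have hp0 : x p = 0 := by_contra fun h => hp (hb _ h)
  obtain ⟨q, hq0, hqp⟩ : ∃ q, x q = 0 ∧ q ≠ p := by
    by_contra! hno
    have hx' := (parity0_update x p).mpr hx
    have : update x p (x p + 1) = fun _ => 1 := by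
      funext j
      by_cases hj : j = p
      · subst hj; simp [hp0]
      · rw [update_of_ne hj]; exact hb _ fun h => hj (hno j h)
    rw [this] at hx'
    have := Nat.odd_iff.mp hodd
    simp [parity0] at hx'
    omega
  rw [hS.shiftStrat_iff_flip_pair hn hodd hx hqp.symm]
  refine ih _ ?_ ?_ rfl
  · rw [← hN]
    refine Finset.card_lt_card
      (Finset.ssubset_iff_of_subset ?_ |>.mpr ⟨q, by simpa using hq0, by simp [hq0]⟩)
    intro j hj
    simp only [Finset.mem_filter, Finset.mem_univ, true_and] at hj ⊢
    by_cases hjq : j = q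
    · rwa [hjq]
    · by_cases hjp : j = p
      · rwa [hjp]
      · rwa [update_of_ne hjq, update_of_ne hjp] at hj
  · have h := parity0_update (update x p (x p + 1)) q
    rw [update_of_ne hqp, parity0_update] at h
    rw [h]; exact fun h => h hx

theorem forall_mem (hS : ExchangeClosed S) (hn : 2 ≤ n) (hodd : Odd n)
    (h1 : S (constStrat fun _ => 1)) (t : Fin n → Fin 2 → Fin 2) : S t := by
  by_cases hc : ∃ i, ∀ a b, t i a = t i b
  · obtain ⟨i, hi⟩ := hc
    obtain ⟨x, hxi, hx⟩ := exists_feedforward t i (t i 0)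
    have h : IsFeedback t x := fun j => by
      by_cases hj : j = i
      · subst hj; rw [hxi]; exact hi _ _
      · exact hx j hj
    by_cases hp : parity0 x
    · exact hS.of_isFeedback hp h
    · exact (hS.iff_shiftStrat hn h hi).mpr (hS.shiftStrat_of_odd hn hodd h1 hp)
  have ht : t = fun j b => b + t j 0 := by
    have hb : ∀ f : Fin 2 → Fin 2, (¬ ∀ a b, f a = f b) → ∀ b, f b = b + f 0 := by decide
    funext j
    exact funext (hb (t j) fun h => hc ⟨j, h⟩)
  obtain ⟨d, rfl⟩ : ∃ d : Fin n → Fin 2, t = fun j b => b + d j := ⟨_, ht⟩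
  let i : Fin n := ⟨0, by omega⟩
  obtain ⟨z, -, hz⟩ := exists_feedforward (fun j b => b + d j) i 0
  have hz' (j : Fin n) (hj : j ≠ i) : z (cnext j) + 1 = z j + 1 + d j := by
    rw [hz j hj]
    generalize z j = a, d j = b
    revert a b; decide
  have hb : ∀ a b e : Fin 2, (a = b + e ∧ a + 1 = b + 1 + e) ∨
      (a = b + e + 1 ∧ a + 1 = b + 1 + e + 1) := by decide
  rcases hb (z (cnext i)) (z i) (d i) with ⟨hi, hi'⟩ | ⟨hi, hi'⟩
  · by_cases hp : parity0 z
    · refine hS.of_isFeedback hp fun j => ?_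
      by_cases hj : j = i
      · rw [hj]; exact hi
      · exact hz j hj
    · refine hS.of_isFeedback ((parity0_compl hodd z).mpr hp) fun j => ?_
      by_cases hj : j = i
      · rw [hj]; exact hi'
      · exact hz' j hj
  · by_cases hp : parity0 z
    · have hp' : ¬ parity0 fun j => z j + 1 := fun h => (parity0_compl hodd z).mp h hp
      exact (hS.add_iff_shiftStrat hn hodd hp' hi' hz').mpr (hS.shiftStrat_of_odd hn hodd h1 hp')
    · exact (hS.add_iff_shiftStrat hn hodd hp hi hz).mpr (hS.shiftStrat_of_odd hn hodd h1 hp)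

end ExchangeClosed

section Boxes

variable {n : ℕ}

lemma stratBox_eq_ite (s : Fin n → Fin 2 → Fin 2) (a x : Fin n → Fin 2) :
    stratBox s (a, x) = if ∀ i, a i = s i (x i) then 1 else 0 := by
  simp [stratBox, Finset.prod_ite_zero]

lemma stratBox_update_add (t : Fin n → Fin 2 → Fin 2) (i : Fin n) (f g : Fin 2 → Fin 2) :
    stratBox (update t i f) + stratBox (update t i fun b => f b + 1) =
      stratBox (update t i g) + stratBox (update t i fun b => g b + 1) := by
  funext ⟨a, x⟩
  have h (f : Fin 2 → Fin 2) : stratBox (update t i f) (a, x) =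
      (if a i = f (x i) then 1 else 0) *
        ∏ j ∈ Finset.univ.erase i, if a j = t j (x j) then (1 : ℝ) else 0 := by
    rw [stratBox, ← Finset.mul_prod_erase _ _ (Finset.mem_univ i)]
    congr 1
    · simp
    · exact Finset.prod_congr rfl fun j hj => by rw [update_of_ne (Finset.ne_of_mem_erase hj)]
  have hb (a b : Fin 2) :
      (if a = b then (1 : ℝ) else 0) + (if a = b + 1 then 1 else 0) = 1 := by
    fin_cases a <;> fin_cases b <;> simp
  simp only [Pi.add_apply, h, ← add_mul, hb]

lemma exchangeClosed_mem_affineSubspace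
    (A : AffineSubspace ℝ ((Fin n → Fin 2) × (Fin n → Fin 2) → ℝ))
    (hA : ∀ s : Fin n → Fin 2 → Fin 2, Saturates s → stratBox s ∈ A) :
    ExchangeClosed fun t : Fin n → Fin 2 → Fin 2 => stratBox t ∈ A where
  of_saturates := hA
  exchange t i f g h₁ h₂ h₃ := by
    have h := A.smul_vsub_vadd_mem (1 : ℝ) h₁ h₃ h₂
    rw [vsub_eq_sub, vadd_eq_add, one_smul] at h
    convert h using 1
    rw [sub_add_eq_add_sub, eq_sub_iff_add_eq]
    exact (stratBox_update_add t i f g).symm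

open Classical in
/-- The GYNI Bell expression `B(p) = ∑_{x even} p(σx | x)`. -/
def gyni (n : ℕ) : ((Fin n → Fin 2) × (Fin n → Fin 2) → ℝ) →ₗ[ℝ] ℝ :=
  ∑ x : Fin n → Fin 2 with parity0 x, LinearMap.proj (fun i => x (cnext i), x)

open Classical in
lemma gyni_stratBox (s : Fin n → Fin 2 → Fin 2) :
    gyni n (stratBox s) =
      (Finset.univ.filter fun x : Fin n → Fin 2 => parity0 x ∧ IsFeedback s x).card := by
  simp only [gyni, LinearMap.sum_apply, LinearMap.proj_apply, stratBox_eq_ite, Finset.sum_boole,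
    Finset.filter_filter]
  congr!

lemma IsFeedback.eq_of_parity0 (hodd : Odd n) {s : Fin n → Fin 2 → Fin 2} {x y : Fin n → Fin 2}
    (hx : IsFeedback s x) (hy : IsFeedback s y) (hpx : parity0 x) (hpy : parity0 y) : x = y := by
  by_cases h : ∃ j, x j = y j
  · obtain ⟨j, hj⟩ := h
    exact funext (cnext_induction (p := fun j => x j = y j) hj
      fun j hj => by rw [hx j, hy j, hj])
  · push Not at h
    have hb : ∀ a b : Fin 2, a ≠ b → b = a + 1 := by decide
    have : y = fun j => x j + 1 := funext fun j => hb _ _ (h j)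
    exact absurd hpx ((parity0_compl hodd x).mp (this ▸ hpy))

lemma gyni_stratBox_of_saturates (hodd : Odd n) {s : Fin n → Fin 2 → Fin 2} (hs : Saturates s) :
    gyni n (stratBox s) = 1 := by
  obtain ⟨x, hp, hx⟩ := hs
  rw [gyni_stratBox, Nat.cast_eq_one, Finset.card_eq_one]
  refine ⟨x, Finset.eq_singleton_iff_unique_mem.mpr ⟨by simpa using ⟨hp, hx⟩, fun y hy => ?_⟩⟩
  simp only [Finset.mem_filter, Finset.mem_univ, true_and] at hy
  exact hy.2.eq_of_parity0 hodd hx hy.1 hp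

open Classical in
lemma gyni_stratBox_one (hodd : Odd n) :
    gyni n (stratBox (constStrat fun _ : Fin n => 1)) = 0 := by
  rw [gyni_stratBox, Nat.cast_eq_zero, Finset.card_eq_zero, Finset.filter_eq_empty_iff]
  rintro x - ⟨hp, hx⟩
  have : x = fun _ => 1 := by
    funext j
    obtain ⟨i, rfl⟩ := ExchangeClosed.exists_cnext_eq j
    exact hx i
  have := Nat.odd_iff.mp hodd
  subst x
  simp [parity0] at hp
  omega

end Boxes

/-- tightness of GYNI_n for odd n: the box of the all-ones constant strategy
is not in the affine span of the boxes of the saturating strategies, while every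
deterministic box lies in the affine span of the saturating boxes together with the
all-ones box; hence the saturating boxes span a facet of the classical polytope. -/
theorem stmt13 {n : ℕ} (hn : 3 ≤ n) (hodd : Odd n) :
    (stratBox (constStrat (fun _ : Fin n => 1)) ∉
      affineSpan ℝ {v | ∃ s : Fin n → Fin 2 → Fin 2, Saturates s ∧ v = stratBox s}) ∧
    (∀ t : Fin n → Fin 2 → Fin 2,
      stratBox t ∈ affineSpan ℝ
        ({v | ∃ s : Fin n → Fin 2 → Fin 2, Saturates s ∧ v = stratBox s} ∪
          {stratBox (constStrat (fun _ : Fin n => 1))})) := by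
  refine ⟨fun hmem => ?_, fun t => ?_⟩
  · have hspan : ∀ v ∈ affineSpan ℝ
        {v | ∃ s : Fin n → Fin 2 → Fin 2, Saturates s ∧ v = stratBox s}, gyni n v = 1 := by
      intro v hv
      refine affineSpan_induction hv ?_ ?_
      · rintro _ ⟨s, hs, rfl⟩
        exact gyni_stratBox_of_saturates hodd hs
      · intro c u v w hu hv hw
        simp [hu, hv, hw]
    have h := hspan _ hmem
    rw [gyni_stratBox_one hodd] at h
    exact zero_ne_one h
  · exact (exchangeClosed_mem_affineSubspace _ fun s hs =>
      subset_affineSpan ℝ _ (Or.inl ⟨s, hs, rfl⟩)).forall_mem (by omega) hodd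
        (subset_affineSpan ℝ _ (Or.inr rfl)) t
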